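/- Assume in addition that Σ is crystallographic. There is a unique continuous function T on D = {(X,Y) ∈ ℝ^d × ℝ^d : X ≠ wY for all w ∈ W} such that T(X,Y) = (π(X)π(Y))^{−1} ∑_{w∈W} det(w) |X − wY|^{−d} whenever (X,Y) ∈ D and π(X)π(Y) ≠ 0; and for every Y ∈ ℝ^d with Y ≠ 0, T(0, Y) = (2^{2γ} (d/2)_γ / π(ρ)) · |Y|^{−d−2γ}, where (d/2)_γ = ∏_{k=0}^{γ−1}(d/2 + k) and π(ρ) = ∏_{α∈Σ⁺} ⟨α, ρ⟩. -/

import Mathlib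

open scoped BigOperators RealInnerProductSpace Classical
open Finset

noncomputable section

/-- Euclidean space `ℝ^d`. -/
abbrev E (d : ℕ) := EuclideanSpace ℝ (Fin d)

/-- The reflection `s_α x = x - 2 (⟪α, x⟫/⟪α, α⟫) α` fixing the hyperplane `α^⊥`. -/
def reflVec {d : ℕ} (α x : E d) : E d := x - (2 * ⟪α, x⟫ / ⟪α, α⟫) • α

/-- `Sig` is a reduced root system in `ℝ^d`: a finite set of nonzero vectors spanning `ℝ^d`,
with `Sig ∩ ℝα = {α, -α}` and `s_α (Sig) = Sig` for all `α ∈ Sig`. -/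
def IsRootSystem {d : ℕ} (Sig : Finset (E d)) : Prop :=
  (0 : E d) ∉ Sig ∧
  Submodule.span ℝ (Sig : Set (E d)) = ⊤ ∧
  (∀ α ∈ Sig, ∀ t : ℝ, t • α ∈ Sig → t = 1 ∨ t = -1) ∧
  (∀ α ∈ Sig, ∀ β ∈ Sig, reflVec α β ∈ Sig)

/-- `Sp` is a positive system for `Sig`: `Sp = {α ∈ Sig : ⟪α, v⟫ > 0}` for a vector `v` not
orthogonal to any root. -/
def IsPositiveSystem {d : ℕ} (Sig Sp : Finset (E d)) : Prop :=
  ∃ v : E d, (∀ α ∈ Sig, ⟪α, v⟫ ≠ 0) ∧ ∀ α : E d, α ∈ Sp ↔ α ∈ Sig ∧ 0 < ⟪α, v⟫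

/-- The Weyl group of `Sig`: the subgroup of the orthogonal group of `ℝ^d` generated by the
reflections `s_α`, `α ∈ Sig`. -/
def weylGroup {d : ℕ} (Sig : Finset (E d)) : Subgroup (E d ≃ₗᵢ[ℝ] E d) :=
  Subgroup.closure {w : E d ≃ₗᵢ[ℝ] E d | ∃ α ∈ Sig, ∀ x : E d, w x = reflVec α x}

/-- Determinant of an orthogonal transformation (`±1`). -/
def dsign {d : ℕ} (w : E d ≃ₗᵢ[ℝ] E d) : ℝ := LinearMap.det (w.toLinearEquiv.toLinearMap)

/-- `π(X) = ∏_{α ∈ Sp} ⟪α, X⟫`. -/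
def piP {d : ℕ} (Sp : Finset (E d)) (X : E d) : ℝ := ∏ α ∈ Sp, ⟪α, X⟫

/-- The set `D = {(X,Y) : X ≠ wY for all w ∈ W}`. -/
def Dset {d : ℕ} (Sig : Finset (E d)) : Set (E d × E d) :=
  {p : E d × E d | ∀ w : weylGroup Sig, p.1 ≠ w.1 p.2}


open MeasureTheory intervalIntegral Topology in
/-- Integrating out a compact-interval parameter preserves `C^n` regularity. -/
theorem contDiff_intervalIntegral_param {V : Type} [NormedAddCommGroup V] [NormedSpace ℝ V]
    [FiniteDimensional ℝ V] (n : ℕ) : ∀ {F : Type} [NormedAddCommGroup F] [NormedSpace ℝ F]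
    [CompleteSpace F] (h : V × ℝ → F), ContDiff ℝ n h →
      ContDiff ℝ n (fun z => ∫ t in (0 : ℝ)..1, h (z, t)) := by
  induction n with
  | zero =>
    intro F _ _ _ h hh
    have hc : Continuous h := hh.continuous
    refine contDiff_zero.2 ?_
    exact continuous_parametric_intervalIntegral_of_continuous'
      (f := fun z t => h (z, t)) hc 0 1
  | succ n ih =>
    intro F _ _ _ h hh
    have hh' : ContDiff ℝ ((n : WithTop ℕ∞) + 1) h := by exact_mod_cast hh
    have hd : Differentiable ℝ h := hh.differentiable (by simp)
    let h' : V × ℝ → (V →L[ℝ] F) := fun p =>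
      (fderiv ℝ h p).comp (ContinuousLinearMap.inl ℝ V ℝ)
    have hh'c : ContDiff ℝ n h' := (hh'.fderiv_right le_rfl).clm_comp contDiff_const
    have hcont : Continuous h' := hh'c.continuous
    have key : ContDiff ℝ ((n : WithTop ℕ∞) + 1) (fun z => ∫ t in (0 : ℝ)..1, h (z, t)) := by
      refine contDiff_succ_iff_hasFDerivAt.2 ⟨fun z => ∫ t in (0 : ℝ)..1, h' (z, t), ih h' hh'c, ?_⟩
      intro z
      obtain ⟨C, hC⟩ := ((isCompact_closedBall z 1).prod
        (isCompact_Icc (a := (0 : ℝ)) (b := 1))).exists_bound_of_continuousOn hcont.continuousOn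
      refine intervalIntegral.hasFDerivAt_integral_of_dominated_of_fderiv_le
        (F := fun z t => h (z, t)) (F' := fun z t => h' (z, t)) (bound := fun _ => C)
        (Metric.closedBall_mem_nhds z one_pos) ?_ ?_ ?_ ?_ ?_ ?_
      · exact Filter.Eventually.of_forall fun x =>
          (hh.continuous.comp (by fun_prop : Continuous fun t : ℝ => (x, t))).aestronglyMeasurable
      · exact (hh.continuous.comp
          (by fun_prop : Continuous fun t : ℝ => (z, t))).intervalIntegrable _ _
      · exact (hcont.comp (by fun_prop : Continuous fun t : ℝ => (z, t))).aestronglyMeasurable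
      · refine Filter.Eventually.of_forall fun t ht x hx => hC (x, t) ⟨hx, ?_⟩
        rw [Set.uIoc_of_le zero_le_one] at ht
        exact Set.Ioc_subset_Icc_self ht
      · exact intervalIntegrable_const
      · refine Filter.Eventually.of_forall fun t _ x _ => ?_
        have h1 : HasFDerivAt (fun y : V => (y, t)) (ContinuousLinearMap.inl ℝ V ℝ) x :=
          hasFDerivAt_prodMk_left x t
        exact (hd (x, t)).hasFDerivAt.comp x h1
    exact_mod_cast key

open MeasureTheory in
/-- Hadamard's lemma: a smooth function vanishing on the kernel of a nonzero linear form is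
a smooth multiple of that form. -/
theorem ContDiff.exists_eq_linear_mul {V : Type} [NormedAddCommGroup V] [NormedSpace ℝ V]
    [FiniteDimensional ℝ V] (l : V →L[ℝ] ℝ) (hl : l ≠ 0) (f : V → ℝ)
    (hf : ContDiff ℝ (⊤ : ℕ∞) f) (h0 : ∀ z, l z = 0 → f z = 0) :
    ∃ g : V → ℝ, ContDiff ℝ (⊤ : ℕ∞) g ∧ ∀ z, f z = l z * g z := by
  obtain ⟨u', hu'⟩ : ∃ u, l u ≠ 0 := by
    by_contra! h
    exact hl (ContinuousLinearMap.ext h)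
  let u : V := (l u')⁻¹ • u'
  have hu : l u = 1 := by simp [u, hu']
  have hd : Differentiable ℝ f := hf.differentiable (by simp)
  have hf' : ContDiff ℝ (⊤ : ℕ∞) (fderiv ℝ f) := hf.fderiv_right (by simp)
  let c : V × ℝ → V := fun p => p.1 - l p.1 • u + p.2 • (l p.1 • u)
  have hc : ContDiff ℝ (⊤ : ℕ∞) c := by fun_prop
  let h : V × ℝ → ℝ := fun p => fderiv ℝ f (c p) u
  have hh : ContDiff ℝ (⊤ : ℕ∞) h := (hf'.comp hc).clm_apply contDiff_const
  refine ⟨fun z => ∫ t in (0 : ℝ)..1, h (z, t), ?_, ?_⟩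
  · refine contDiff_infty.2 fun n => contDiff_intervalIntegral_param n h (hh.of_le ?_)
    exact_mod_cast le_top
  · intro z
    have hderiv : ∀ t ∈ Set.uIcc (0 : ℝ) 1,
        HasDerivAt (fun t : ℝ => f (c (z, t))) (l z * h (z, t)) t := by
      intro t _
      have h1 : HasDerivAt (fun t : ℝ => c (z, t)) (l z • u) t := by
        have := ((hasDerivAt_id t).smul_const (l z • u)).const_add (z - l z • u)
        simpa [c] using this
      have h2 := (hd (c (z, t))).hasFDerivAt.comp_hasDerivAt t h1
      have e : l z * h (z, t) = fderiv ℝ f (c (z, t)) (l z • u) := by simp [h]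
      rw [e]
      exact h2
    have hcont : Continuous fun t : ℝ => l z * h (z, t) :=
      continuous_const.mul (hh.continuous.comp (by fun_prop))
    have := intervalIntegral.integral_eq_sub_of_hasDerivAt hderiv (hcont.intervalIntegrable _ _)
    rw [intervalIntegral.integral_const_mul] at this
    rw [this]
    have e1 : c (z, 1) = z := by simp [c]
    have e0 : f (c (z, 0)) = 0 := h0 _ (by simp [c, hu])
    simp only [e1, e0, sub_zero]

open Topology in
/-- A smooth function vanishing on the kernels of finitely many pairwise independent linear forms
is a smooth multiple of their product. -/
theorem ContDiff.exists_eq_prod_linear_mul {V ι : Type} [NormedAddCommGroup V] [NormedSpace ℝ V]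
    [FiniteDimensional ℝ V] (l : ι → V →L[ℝ] ℝ) (s : Finset ι) (hl : ∀ i ∈ s, l i ≠ 0)
    (hind : ∀ i ∈ s, ∀ j ∈ s, i ≠ j → ∃ u, l j u = 0 ∧ l i u ≠ 0) (f : V → ℝ)
    (hf : ContDiff ℝ (⊤ : ℕ∞) f) (h0 : ∀ i ∈ s, ∀ z, l i z = 0 → f z = 0) :
    ∃ g : V → ℝ, ContDiff ℝ (⊤ : ℕ∞) g ∧ ∀ z, f z = (∏ i ∈ s, l i z) * g z := by
  induction s using Finset.induction_on generalizing f with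
  | empty => exact ⟨f, hf, by simp⟩
  | insert i s hi ih =>
    obtain ⟨g, hg, hfg⟩ := hf.exists_eq_linear_mul (l i) (hl i (mem_insert_self _ _)) f
      (h0 i (mem_insert_self _ _))
    have hg0 : ∀ j ∈ s, ∀ z, l j z = 0 → g z = 0 := by
      intro j hj z hz
      obtain ⟨u, hju, hiu⟩ := hind i (mem_insert_self _ _) j (mem_insert_of_mem hj)
        (by rintro rfl; exact hi hj)
      by_contra hgz
      have hc : Continuous fun t : ℝ => g (z + t • u) := hg.continuous.comp (by fun_prop)
      have hev : ∀ᶠ t : ℝ in 𝓝 0, g (z + t • u) ≠ 0 :=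
        hc.continuousAt.eventually_ne (by simpa using hgz)
      have hz2 : ∀ t : ℝ, g (z + t • u) ≠ 0 → l i z + t * l i u = 0 := by
        intro t ht
        have h1 := hfg (z + t • u)
        rw [h0 j (mem_insert_of_mem hj) _ (by simp [hz, hju])] at h1
        have := (mul_eq_zero.1 h1.symm).resolve_right ht
        simpa using this
      have hz0 : l i z = 0 := by simpa using hz2 0 hev.self_of_nhds
      have hev' := (hev.filter_mono (nhdsWithin_le_nhds (s := {0}ᶜ))).and self_mem_nhdsWithin
      obtain ⟨t, ht, ht0⟩ := hev'.exists
      have := hz2 t ht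
      rw [hz0, zero_add] at this
      exact (mul_ne_zero ht0 hiu) this
    obtain ⟨k, hk, hgk⟩ := ih (fun j hj => hl j (mem_insert_of_mem hj))
      (fun j hj k hk => hind j (mem_insert_of_mem hj) k (mem_insert_of_mem hk)) g hg hg0
    refine ⟨k, hk, fun z => ?_⟩
    rw [hfg, hgk, prod_insert hi, mul_assoc]

open Filter Topology in
/-- A polynomial of degree at most `n` which is `o(t ^ n)` at the origin vanishes. -/
theorem coeff_eq_zero_of_tendsto_div_pow (n : ℕ) : ∀ a : ℕ → ℝ,
    Tendsto (fun t : ℝ => (∑ k ∈ range (n + 1), a k * t ^ k) / t ^ n) (𝓝[≠] 0) (𝓝 0) →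
      ∀ k ≤ n, a k = 0 := by
  induction n with
  | zero =>
    intro a h k hk
    obtain rfl : k = 0 := by omega
    have h' : Tendsto (fun _ : ℝ => a 0) (𝓝[≠] 0) (𝓝 0) := by simpa using h
    exact tendsto_nhds_unique tendsto_const_nhds h'
  | succ n ih =>
    intro a h
    have hpow : Tendsto (fun t : ℝ => t ^ (n + 1)) (𝓝[≠] 0) (𝓝 0) := by
      have : Continuous fun t : ℝ => t ^ (n + 1) := by fun_prop
      simpa using (this.tendsto 0).mono_left nhdsWithin_le_nhds
    have h1 : Tendsto (fun t : ℝ => ∑ k ∈ range (n + 1 + 1), a k * t ^ k) (𝓝[≠] 0) (𝓝 0) := by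
      have := h.mul hpow
      rw [zero_mul] at this
      refine this.congr' ?_
      filter_upwards [self_mem_nhdsWithin] with t ht
      exact div_mul_cancel₀ _ (pow_ne_zero _ ht)
    have h2 : Tendsto (fun t : ℝ => ∑ k ∈ range (n + 1 + 1), a k * t ^ k) (𝓝[≠] 0) (𝓝 (a 0)) := by
      have : Continuous fun t : ℝ => ∑ k ∈ range (n + 1 + 1), a k * t ^ k := by fun_prop
      have h3 := (this.tendsto 0).mono_left (nhdsWithin_le_nhds (s := {0}ᶜ))
      rw [sum_range_succ'] at h3
      simpa using h3
    have ha0 : a 0 = 0 := tendsto_nhds_unique h2 h1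
    have hih := ih (fun k => a (k + 1)) (h.congr' (by
      filter_upwards [self_mem_nhdsWithin] with t ht
      have ht : t ≠ 0 := ht
      rw [sum_range_succ', ha0, zero_mul, add_zero, pow_succ, ← mul_div_mul_right _ (t ^ n) ht,
        sum_mul]
      congr 1
      exact sum_congr rfl fun k _ => by ring))
    intro k hk
    rcases k with _ | k
    · exact ha0
    · exact hih k (by omega)

open Filter Topology Asymptotics in
/-- Taylor expansion of the superposition `∑ cᵢ f (u bᵢ)` in terms of the moments of the weights. -/
theorem isLittleO_sum_sub_moments {ι κ : Type*} [Fintype ι] (c b : ι → ℝ) (f : ℝ → ℝ) (q : ℕ → ℝ)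
    (n : ℕ) (hf : (fun x => f x - ∑ k ∈ range (n + 1), q k * x ^ k) =o[𝓝 0] fun x => x ^ n)
    (l : Filter κ) (u : κ → ℝ) (hu : Tendsto u l (𝓝 0)) :
    (fun t => ∑ i, c i * f (u t * b i) -
      ∑ k ∈ range (n + 1), q k * (∑ i, c i * b i ^ k) * u t ^ k) =o[l] fun t => u t ^ n := by
  have h1 : ∀ i, (fun t => c i * (f (u t * b i) - ∑ k ∈ range (n + 1), q k * (u t * b i) ^ k))
      =o[l] fun t => u t ^ n := by
    intro i
    refine IsLittleO.const_mul_left ?_ _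
    have hub : Tendsto (fun t => u t * b i) l (𝓝 0) := by simpa using hu.mul_const (b i)
    refine (hf.comp_tendsto hub).trans_isBigO ?_
    have : ((fun x : ℝ => x ^ n) ∘ fun t => u t * b i) = fun t => b i ^ n * u t ^ n := by
      ext t; simp [mul_pow, mul_comm]
    rw [this]
    exact (isBigO_refl _ _).const_mul_left _
  have h2 := IsLittleO.sum fun i (_ : i ∈ (univ : Finset ι)) => h1 i
  refine h2.congr_left fun t => ?_
  rw [Finset.sum_apply]
  simp only [mul_sub, sum_sub_distrib]
  congr 1
  simp only [mul_sum, sum_mul]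
  rw [sum_comm]
  exact sum_congr rfl fun k _ => sum_congr rfl fun i _ => by rw [mul_pow]; ring

open Filter Topology Asymptotics in
/-- The order of vanishing and the leading coefficient of `∑ cᵢ exp (t bᵢ)` at `t = 0` determine
the first moments of the weights. -/
theorem moments_of_tendsto_sum_exp {ι : Type*} [Fintype ι] (c b : ι → ℝ) (n : ℕ) (L : ℝ)
    (h : Tendsto (fun t : ℝ => (∑ i, c i * Real.exp (t * b i)) / t ^ n) (𝓝[≠] 0) (𝓝 L)) :
    (∀ k < n, ∑ i, c i * b i ^ k = 0) ∧ ∑ i, c i * b i ^ n = n.factorial * L := by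
  have hexp : (fun x => Real.exp x - ∑ k ∈ range (n + 1), ((k.factorial : ℝ)⁻¹) * x ^ k)
      =o[𝓝 0] fun x => x ^ n := by
    have h1 := Real.exp_sub_sum_range_succ_isLittleO_pow n
    refine h1.congr_left fun x => ?_
    congr 1
    exact sum_congr rfl fun k _ => by rw [div_eq_inv_mul]
  have h2 := isLittleO_sum_sub_moments c b Real.exp _ n hexp (𝓝[≠] (0 : ℝ)) id
    (tendsto_id.mono_left nhdsWithin_le_nhds)
  have h3 := h.sub h2.tendsto_div_nhds_zero
  rw [sub_zero] at h3
  have h4 := coeff_eq_zero_of_tendsto_div_pow n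
    (fun k => ((k.factorial : ℝ)⁻¹) * (∑ i, c i * b i ^ k) - if k = n then L else 0) (by
      have h5 := h3.sub_const L
      rw [sub_self] at h5
      refine h5.congr' ?_
      filter_upwards [self_mem_nhdsWithin] with t ht
      have ht : t ≠ 0 := ht
      simp only [id, sub_mul, sum_sub_distrib, ite_mul, zero_mul, sum_ite_eq', mem_range,
        Nat.lt_succ_self, if_true]
      field_simp
      ring)
  constructor
  · intro k hk
    have := h4 k hk.le
    rw [if_neg hk.ne, sub_zero] at this
    exact (mul_eq_zero.1 this).resolve_left (by positivity)
  · have := h4 n le_rfl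
    rw [if_pos rfl, sub_eq_zero] at this
    rw [← this]
    field_simp

/-- Rising factorials as binomial coefficients. -/
theorem ringChoose_eq_prod_div (s : ℝ) (n : ℕ) :
    Ring.choose (s + n - 1) n = (∏ k ∈ range n, (s + k)) / n.factorial := by
  rw [← Ring.multichoose_eq, eq_div_iff (by positivity), mul_comm, ← nsmul_eq_mul,
    Ring.factorial_nsmul_multichoose_eq_ascPochhammer, Polynomial.ascPochhammer_smeval_eq_eval]
  induction n with
  | zero => simp
  | succ n ih => rw [ascPochhammer_succ_eval, prod_range_succ, ih]

open Filter Topology Asymptotics in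
theorem isLittleO_one_sub_rpow (s : ℝ) (n : ℕ) :
    (fun x : ℝ => (1 - x) ^ (-s) - ∑ k ∈ range (n + 1),
      ((∏ j ∈ range k, (s + j)) / k.factorial) * x ^ k) =o[𝓝 0] fun x => x ^ n := by
  have h := ((Real.one_div_one_sub_rpow_hasFPowerSeriesOnBall_zero s).hasFPowerSeriesAt
    ).isBigO_sub_partialSum_pow (n + 1)
  have h1 : (fun x : ℝ => ‖x‖ ^ (n + 1)) =o[𝓝 0] fun x => x ^ n := by
    have : (fun x : ℝ => x ^ (n + 1)) =o[𝓝 0] fun x => x ^ n := by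
      exact isLittleO_pow_pow (Nat.lt_succ_self n)
    simpa only [norm_pow] using this.norm_left
  refine (h.trans_isLittleO h1).congr' ?_ EventuallyEq.rfl
  have hlt : ∀ᶠ x : ℝ in 𝓝 0, x < 1 := eventually_lt_nhds one_pos
  filter_upwards [hlt] with x hx
  rw [zero_add, FormalMultilinearSeries.partialSum, Real.rpow_neg (by linarith), one_div]
  congr 1
  refine sum_congr rfl fun k _ => ?_
  rw [← ringChoose_eq_prod_div]
  simp [mul_comm]

open Filter Topology Asymptotics in
/-- Leading asymptotics of `∑ cᵢ (r(t) - 2 t bᵢ) ^ (-s)` when the first moments vanish. -/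
theorem tendsto_sum_rpow_div_pow {ι : Type*} [Fintype ι] (c b : ι → ℝ) (n : ℕ) (s M : ℝ)
    (hzero : ∀ k < n, ∑ i, c i * b i ^ k = 0) (hM : ∑ i, c i * b i ^ n = M)
    (r : ℝ → ℝ) (r0 : ℝ) (hr0 : 0 < r0) (hr : Tendsto r (𝓝[≠] 0) (𝓝 r0)) :
    Tendsto (fun t : ℝ => (∑ i, c i * (r t - 2 * t * b i) ^ (-s)) / t ^ n) (𝓝[≠] 0)
      (𝓝 (r0 ^ (-s) * ((∏ j ∈ range n, (s + j)) / n.factorial * M * (2 / r0) ^ n))) := by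
  have hid : Tendsto (fun t : ℝ => t) (𝓝[≠] 0) (𝓝 0) := tendsto_id.mono_left nhdsWithin_le_nhds
  have hu : Tendsto (fun t => 2 * t / r t) (𝓝[≠] 0) (𝓝 0) := by
    have := (hid.const_mul 2).div hr hr0.ne'
    rw [mul_zero, zero_div] at this
    exact this
  have hpos : ∀ᶠ t in 𝓝[≠] (0 : ℝ), 0 < r t := hr.eventually (lt_mem_nhds hr0)
  have h := (isLittleO_sum_sub_moments c b (fun x => (1 - x) ^ (-s)) _ n
    (isLittleO_one_sub_rpow s n) (𝓝[≠] (0 : ℝ)) _ hu).tendsto_div_nhds_zero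
  have h2 : Tendsto (fun t => (2 / r t) ^ n) (𝓝[≠] 0) (𝓝 ((2 / r0) ^ n)) :=
    (tendsto_const_nhds.div hr hr0.ne').pow n
  have h3 : Tendsto (fun t => r t ^ (-s)) (𝓝[≠] 0) (𝓝 (r0 ^ (-s))) :=
    hr.rpow_const (Or.inl hr0.ne')
  have h4 := h3.mul ((h.add_const ((∏ j ∈ range n, (s + j)) / n.factorial * M)).mul h2)
  rw [zero_add] at h4
  refine h4.congr' ?_
  have hsmall : ∀ᶠ t in 𝓝[≠] (0 : ℝ), ∀ i, 2 * t / r t * b i < 1 := by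
    refine eventually_all.2 fun i => ?_
    have : Tendsto (fun t => 2 * t / r t * b i) (𝓝[≠] 0) (𝓝 0) := by simpa using hu.mul_const (b i)
    exact this.eventually (gt_mem_nhds one_pos)
  filter_upwards [hpos, hsmall, self_mem_nhdsWithin] with t hrt hst ht
  have ht : t ≠ 0 := ht
  have e1 : ∀ i, (r t - 2 * t * b i) ^ (-s) = r t ^ (-s) * (1 - 2 * t / r t * b i) ^ (-s) := by
    intro i
    rw [← Real.mul_rpow hrt.le (by linarith [hst i])]
    congr 1
    field_simp
  have e2 : ∑ k ∈ range (n + 1), (∏ j ∈ range k, (s + j)) / k.factorial *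
      (∑ i, c i * b i ^ k) * (2 * t / r t) ^ k =
      (∏ j ∈ range n, (s + j)) / n.factorial * M * (2 * t / r t) ^ n := by
    rw [sum_range_succ, hM, sum_eq_zero, zero_add]
    intro k hk
    rw [hzero k (mem_range.1 hk)]
    ring
  rw [e2]
  have e3 : ∑ i, c i * (r t - 2 * t * b i) ^ (-s) =
      r t ^ (-s) * ∑ i, c i * (1 - 2 * t / r t * b i) ^ (-s) := by
    rw [mul_sum]
    exact sum_congr rfl fun i _ => by rw [e1]; ring
  rw [e3]
  have hrt' := hrt.ne'
  simp only [div_pow, mul_pow]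
  field_simp
  ring

/-- The reflection in the hyperplane orthogonal to `α`, as a linear isometry. -/
def sref {d : ℕ} (α : E d) : E d ≃ₗᵢ[ℝ] E d := (Submodule.span ℝ {α})ᗮ.reflection

theorem sref_apply {d : ℕ} (α x : E d) : sref α x = reflVec α x := by
  rw [sref, Submodule.reflection_orthogonal_apply, Submodule.reflection_singleton_apply, reflVec,
    real_inner_self_eq_norm_sq]
  simp only [RCLike.ofReal_real_eq_id, id]
  module

theorem sref_self {d : ℕ} {α : E d} (hα : α ≠ 0) : sref α α = -α := by
  have : ⟪α, α⟫ ≠ 0 := by simpa using hα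
  rw [sref_apply, reflVec, mul_div_assoc, div_self this]
  module

theorem sref_sref {d : ℕ} (α x : E d) : sref α (sref α x) = x :=
  Submodule.reflection_reflection _ x

theorem sref_mul_self {d : ℕ} (α : E d) : sref α * sref α = 1 := by
  ext1 x
  exact sref_sref α x

theorem sref_inv {d : ℕ} (α : E d) : (sref α)⁻¹ = sref α :=
  inv_eq_of_mul_eq_one_right (sref_mul_self α)

theorem sref_neg {d : ℕ} (α : E d) : sref (-α) = sref α := by
  ext1 x
  simp [sref_apply, reflVec, neg_div, sub_eq_add_neg]

theorem sref_conj {d : ℕ} (w : E d ≃ₗᵢ[ℝ] E d) (α : E d) : sref (w α) = w * sref α * w⁻¹ := by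
  ext1 x
  have h1 : ⟪w α, x⟫ = ⟪α, w⁻¹ x⟫ := by
    conv_lhs => rw [← w.apply_symm_apply x]
    rw [w.inner_map_map]
    rfl
  have h2 : w (w⁻¹ x) = x := w.apply_symm_apply x
  rw [LinearIsometryEquiv.coe_mul, LinearIsometryEquiv.coe_mul]
  simp only [Function.comp_apply, sref_apply, reflVec, w.inner_map_map, h1, map_sub, map_smul, h2]

theorem sref_eq_self_of_inner_eq_zero {d : ℕ} {α x : E d} (h : ⟪α, x⟫ = 0) : sref α x = x := by
  simp [sref_apply, reflVec, h]

theorem dsign_mul {d : ℕ} (u w : E d ≃ₗᵢ[ℝ] E d) : dsign (u * w) = dsign u * dsign w := by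
  unfold dsign
  rw [← LinearMap.det_comp]
  rfl

theorem dsign_one {d : ℕ} : dsign (1 : E d ≃ₗᵢ[ℝ] E d) = 1 := by
  unfold dsign
  exact LinearMap.det_id

theorem dsign_sref {d : ℕ} {α : E d} (hα : α ≠ 0) : dsign (sref α) = -1 := by
  have h := Submodule.det_reflection (Submodule.span ℝ {α})ᗮ
  rw [Submodule.orthogonal_orthogonal, finrank_span_singleton hα, pow_one] at h
  exact h

theorem inner_left_eq_inner_inv {d : ℕ} (w : E d ≃ₗᵢ[ℝ] E d) (x y : E d) :
    ⟪w x, y⟫ = ⟪x, w⁻¹ y⟫ := by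
  conv_lhs => rw [← w.apply_symm_apply y]
  rw [w.inner_map_map]
  rfl

/-- A positive root all of whose fellow positive roots stay positive under its reflection. -/
def IsSimple {d : ℕ} (Sp : Finset (E d)) (α : E d) : Prop :=
  α ∈ Sp ∧ ∀ β ∈ Sp, β ≠ α → sref α β ∈ Sp

/-- A crystallographic root system with the positive system cut out by the vector `v`. -/
structure IsPosRoots {d : ℕ} (Sig Sp : Finset (E d)) (v : E d) : Prop where
  root : IsRootSystem Sig
  crys : ∀ α ∈ Sig, ∀ β ∈ Sig, ∃ z : ℤ, 2 * ⟪α, β⟫ / ⟪β, β⟫ = (z : ℝ)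
  inner_ne : ∀ α ∈ Sig, ⟪α, v⟫ ≠ 0
  mem_iff : ∀ α : E d, α ∈ Sp ↔ α ∈ Sig ∧ 0 < ⟪α, v⟫

namespace IsPosRoots

variable {d : ℕ} {Sig Sp : Finset (E d)} {v : E d}

theorem mem_sig (h : IsPosRoots Sig Sp v) {α : E d} (hα : α ∈ Sp) : α ∈ Sig :=
  ((h.mem_iff α).1 hα).1

theorem height_pos (h : IsPosRoots Sig Sp v) {α : E d} (hα : α ∈ Sp) : 0 < ⟪α, v⟫ :=
  ((h.mem_iff α).1 hα).2

theorem sig_ne_zero (h : IsPosRoots Sig Sp v) {α : E d} (hα : α ∈ Sig) : α ≠ 0 := by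
  rintro rfl
  exact h.root.1 hα

theorem ne_zero (h : IsPosRoots Sig Sp v) {α : E d} (hα : α ∈ Sp) : α ≠ 0 :=
  h.sig_ne_zero (h.mem_sig hα)

theorem sref_mem_sig (h : IsPosRoots Sig Sp v) {α β : E d} (hα : α ∈ Sig) (hβ : β ∈ Sig) :
    sref α β ∈ Sig := by
  rw [sref_apply]
  exact h.root.2.2.2 α hα β hβ

theorem neg_mem (h : IsPosRoots Sig Sp v) {α : E d} (hα : α ∈ Sig) : -α ∈ Sig := by
  have := h.sref_mem_sig hα hα
  rwa [sref_self (h.sig_ne_zero hα)] at this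

theorem neg_mem_of_notMem (h : IsPosRoots Sig Sp v) {α : E d} (hα : α ∈ Sig) (hn : α ∉ Sp) :
    -α ∈ Sp := by
  refine (h.mem_iff _).2 ⟨h.neg_mem hα, ?_⟩
  rw [inner_neg_left]
  have h1 := h.inner_ne α hα
  have h2 : ¬ 0 < ⟪α, v⟫ := fun hp => hn ((h.mem_iff _).2 ⟨hα, hp⟩)
  have h3 := lt_of_le_of_ne (not_lt.1 h2) h1
  linarith

theorem neg_notMem (h : IsPosRoots Sig Sp v) {α : E d} (hα : α ∈ Sp) : -α ∉ Sp := by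
  intro hn
  have h1 := h.height_pos hn
  have h2 := h.height_pos hα
  rw [inner_neg_left] at h1
  linarith

theorem sub_mem (h : IsPosRoots Sig Sp v) {α β : E d} (hα : α ∈ Sig) (hβ : β ∈ Sig)
    (hne : α ≠ β) (hpos : 0 < ⟪α, β⟫) : α - β ∈ Sig := by
  obtain ⟨a, ha⟩ := h.crys α hα β hβ
  obtain ⟨b, hb⟩ := h.crys β hβ α hα
  have hα0 : 0 < ⟪α, α⟫ := real_inner_self_pos.2 (h.sig_ne_zero hα)
  have hβ0 : 0 < ⟪β, β⟫ := real_inner_self_pos.2 (h.sig_ne_zero hβ)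
  have hsymm : ⟪β, α⟫ = ⟪α, β⟫ := real_inner_comm _ _
  have ha0 : 0 < a := by
    have : (0 : ℝ) < a := by rw [← ha]; positivity
    exact_mod_cast this
  have hb0 : 0 < b := by
    have : (0 : ℝ) < b := by rw [← hb, hsymm]; positivity
    exact_mod_cast this
  by_cases ha1 : a = 1
  · have := h.sref_mem_sig hβ hα
    rwa [sref_apply, reflVec, hsymm, ha, ha1, Int.cast_one, one_smul] at this
  by_cases hb1 : b = 1
  · have := h.neg_mem (h.sref_mem_sig hα hβ)
    rwa [sref_apply, reflVec, ← hsymm, hb, hb1, Int.cast_one, one_smul, neg_sub] at this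
  exfalso
  have ha2 : (2 : ℝ) ≤ a := by exact_mod_cast (by omega : (2 : ℤ) ≤ a)
  have hb2 : (2 : ℝ) ≤ b := by exact_mod_cast (by omega : (2 : ℤ) ≤ b)
  rw [← ha, le_div_iff₀ hβ0] at ha2
  rw [← hb, le_div_iff₀ hα0, hsymm] at hb2
  have h0 : ⟪α - β, α - β⟫ ≤ 0 := by
    rw [real_inner_sub_sub_self]
    linarith
  exact hne (sub_eq_zero.1 (real_inner_self_nonpos.1 h0))

theorem isSimple_of_indecomposable (h : IsPosRoots Sig Sp v) {α : E d} (hα : α ∈ Sp)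
    (hind : ∀ β ∈ Sp, ∀ γ ∈ Sp, β + γ ≠ α) : IsSimple Sp α := by
  refine ⟨hα, ?_⟩
  by_contra! hbad
  obtain ⟨β₀, hβ₀, hne₀, hb₀⟩ := hbad
  obtain ⟨β, hβmem, hmin⟩ := exists_min_image (Sp.filter fun β => β ≠ α ∧ sref α β ∉ Sp)
    (fun β => ⟪β, v⟫) ⟨β₀, mem_filter.2 ⟨hβ₀, hne₀, hb₀⟩⟩
  obtain ⟨hβ, hne, hb⟩ := mem_filter.1 hβmem
  have hαS := h.mem_sig hα
  have hβS := h.mem_sig hβ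
  have hα0 : 0 < ⟪α, α⟫ := real_inner_self_pos.2 (h.ne_zero hα)
  rcases le_or_gt ⟪β, α⟫ 0 with hle | hgt
  · refine hb ((h.mem_iff _).2 ⟨h.sref_mem_sig hαS hβS, ?_⟩)
    rw [sref_apply, reflVec, inner_sub_left, inner_smul_left, real_inner_comm β α]
    have h1 : 2 * ⟪β, α⟫ / ⟪α, α⟫ ≤ 0 := div_nonpos_of_nonpos_of_nonneg (by linarith) hα0.le
    have h2 := mul_nonneg (neg_nonneg.2 h1) (h.height_pos hα).le
    have h3 := h.height_pos hβ
    simp only [conj_trivial]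
    linarith
  · have hsub := h.sub_mem hβS hαS hne hgt
    have hsubp : β - α ∈ Sp := by
      by_contra hn
      exact hind _ (h.neg_mem_of_notMem hsub hn) β hβ (by abel)
    have hne2 : β - α ≠ α := by
      intro he
      have h2 : (2 : ℝ) • α ∈ Sig := by
        have : (2 : ℝ) • α = β := by rw [two_smul, ← sub_eq_iff_eq_add.1 he]
        rwa [this]
      rcases h.root.2.2.1 α hαS 2 h2 with h3 | h3 <;> norm_num at h3
    have hgood : sref α (β - α) ∈ Sp := by
      by_contra hn
      have := hmin _ (mem_filter.2 ⟨hsubp, hne2, hn⟩)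
      rw [inner_sub_left] at this
      have := h.height_pos hα
      linarith
    refine hind _ hgood _ (h.neg_mem_of_notMem (h.sref_mem_sig hαS hβS) hb) ?_
    rw [map_sub, sref_self (h.ne_zero hα)]
    abel

theorem induction_on (h : IsPosRoots Sig Sp v) {P : E d → Prop}
    (hs : ∀ α, IsSimple Sp α → P α) (hadd : ∀ β ∈ Sp, ∀ γ ∈ Sp, P β → P γ → P (β + γ)) :
    ∀ β ∈ Sp, P β := by
  by_contra! hbad
  obtain ⟨β₀, hβ₀, hb₀⟩ := hbad
  obtain ⟨β, hβmem, hmin⟩ := exists_min_image (Sp.filter fun β => ¬ P β)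
    (fun β => ⟪β, v⟫) ⟨β₀, mem_filter.2 ⟨hβ₀, hb₀⟩⟩
  obtain ⟨hβ, hb⟩ := mem_filter.1 hβmem
  by_cases hd : ∀ γ ∈ Sp, ∀ δ ∈ Sp, γ + δ ≠ β
  · exact hb (hs β (h.isSimple_of_indecomposable hβ hd))
  push Not at hd
  obtain ⟨γ, hγ, δ, hδ, rfl⟩ := hd
  have h1 := h.height_pos hγ
  have h2 := h.height_pos hδ
  refine hb (hadd γ hγ δ hδ ?_ ?_)
  · by_contra hn
    have := hmin _ (mem_filter.2 ⟨hγ, hn⟩)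
    rw [inner_add_left] at this
    linarith
  · by_contra hn
    have := hmin _ (mem_filter.2 ⟨hδ, hn⟩)
    rw [inner_add_left] at this
    linarith

theorem sref_mem_erase (h : IsPosRoots Sig Sp v) {α β : E d} (hα : IsSimple Sp α)
    (hβ : β ∈ Sp.erase α) : sref α β ∈ Sp.erase α := by
  obtain ⟨hne, hβ⟩ := mem_erase.1 hβ
  refine mem_erase.2 ⟨fun he => ?_, hα.2 β hβ hne⟩
  have h1 : β = -α := by rw [← sref_sref α β, he, sref_self (h.ne_zero hα.1)]
  exact h.neg_notMem hα.1 (h1 ▸ hβ)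

@[to_additive]
theorem prod_erase_sref (h : IsPosRoots Sig Sp v) {M : Type*} [CommMonoid M] {α : E d}
    (hα : IsSimple Sp α) (F : E d → M) :
    ∏ β ∈ Sp.erase α, F (sref α β) = ∏ β ∈ Sp.erase α, F β :=
  prod_nbij' (sref α) (sref α) (fun _ hβ => h.sref_mem_erase hα hβ)
    (fun _ hβ => h.sref_mem_erase hα hβ) (fun β _ => sref_sref α β) (fun β _ => sref_sref α β)
    (fun _ _ => rfl)

theorem sref_rho (h : IsPosRoots Sig Sp v) {α : E d} (hα : IsSimple Sp α) :
    sref α (∑ β ∈ Sp, β) = (∑ β ∈ Sp, β) - (2 : ℝ) • α := by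
  rw [map_sum, ← add_sum_erase Sp _ hα.1, ← add_sum_erase Sp _ hα.1,
    h.sum_erase_sref hα fun β => β, sref_self (h.ne_zero hα.1)]
  module

theorem inner_simple_rho (h : IsPosRoots Sig Sp v) {α : E d} (hα : IsSimple Sp α) :
    ⟪α, ∑ β ∈ Sp, β⟫ = ⟪α, α⟫ := by
  have h1 : ⟪α, sref α (∑ β ∈ Sp, β)⟫ = -⟪α, ∑ β ∈ Sp, β⟫ := by
    rw [← inner_neg_left, ← sref_self (h.ne_zero hα.1), LinearIsometryEquiv.inner_map_eq_flip]
    rfl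
  rw [h.sref_rho hα, inner_sub_right, inner_smul_right] at h1
  linarith

theorem inner_rho_pos (h : IsPosRoots Sig Sp v) : ∀ β ∈ Sp, 0 < ⟪β, ∑ α ∈ Sp, α⟫ := by
  refine h.induction_on (fun α hα => ?_) fun β _ γ _ h1 h2 => ?_
  · rw [h.inner_simple_rho hα]
    exact real_inner_self_pos.2 (h.ne_zero hα.1)
  · rw [inner_add_left]
    exact add_pos h1 h2

theorem sref_mem_weylGroup {α : E d} (hα : α ∈ Sig) : sref α ∈ weylGroup Sig :=
  Subgroup.subset_closure ⟨α, hα, fun x => sref_apply α x⟩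

theorem sref_mem_closure_simple (h : IsPosRoots Sig Sp v) :
    ∀ β ∈ Sp, sref β ∈ Subgroup.closure {w : E d ≃ₗᵢ[ℝ] E d | ∃ α, IsSimple Sp α ∧ w = sref α} := by
  by_contra! hbad
  obtain ⟨β₀, hβ₀, hb₀⟩ := hbad
  obtain ⟨β, hβmem, hmin⟩ := exists_min_image (Sp.filter fun β => sref β ∉
      Subgroup.closure {w : E d ≃ₗᵢ[ℝ] E d | ∃ α, IsSimple Sp α ∧ w = sref α})
    (fun β => ⟪β, v⟫) ⟨β₀, mem_filter.2 ⟨hβ₀, hb₀⟩⟩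
  obtain ⟨hβ, hb⟩ := mem_filter.1 hβmem
  obtain ⟨α, hα, hpos⟩ : ∃ α, IsSimple Sp α ∧ 0 < ⟪α, β⟫ := by
    by_contra! hn
    have := h.induction_on (P := fun γ => ⟪γ, β⟫ ≤ 0) hn (fun γ _ δ _ h1 h2 => by
      rw [inner_add_left]; exact add_nonpos h1 h2) β hβ
    exact h.ne_zero hβ (real_inner_self_nonpos.1 this)
  have hmem : sref α ∈
      Subgroup.closure {w : E d ≃ₗᵢ[ℝ] E d | ∃ α, IsSimple Sp α ∧ w = sref α} :=
    Subgroup.subset_closure ⟨α, hα, rfl⟩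
  have hne : β ≠ α := by
    rintro rfl
    exact hb hmem
  have hgood : sref (sref α β) ∈
      Subgroup.closure {w : E d ≃ₗᵢ[ℝ] E d | ∃ α, IsSimple Sp α ∧ w = sref α} := by
    by_contra hn
    have h1 := hmin _ (mem_filter.2 ⟨hα.2 β hβ hne, hn⟩)
    rw [sref_apply, reflVec, inner_sub_left, inner_smul_left] at h1
    have h2 : 0 < 2 * ⟪α, β⟫ / ⟪α, α⟫ :=
      div_pos (by linarith) (real_inner_self_pos.2 (h.ne_zero hα.1))
    have h3 := mul_pos h2 (h.height_pos hα.1)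
    simp only [conj_trivial] at h1
    linarith
  refine hb ?_
  have h4 : sref β = sref α * sref (sref α β) * (sref α)⁻¹ := by
    rw [← sref_conj, sref_sref]
  rw [h4]
  exact mul_mem (mul_mem hmem hgood) (inv_mem hmem)

theorem exists_simple_word (h : IsPosRoots Sig Sp v) {w : E d ≃ₗᵢ[ℝ] E d}
    (hw : w ∈ weylGroup Sig) :
    ∃ l : List (E d), (∀ α ∈ l, IsSimple Sp α) ∧ (l.map sref).prod = w := by
  have hmem : w ∈ Subgroup.closure {w : E d ≃ₗᵢ[ℝ] E d | ∃ α, IsSimple Sp α ∧ w = sref α} := by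
    refine (Subgroup.closure_le _).2 ?_ hw
    rintro s ⟨α, hα, hs⟩
    have hs' : s = sref α := by
      ext1 x
      rw [hs, sref_apply]
    rw [hs']
    by_cases hp : α ∈ Sp
    · exact h.sref_mem_closure_simple α hp
    · have := h.sref_mem_closure_simple _ (h.neg_mem_of_notMem hα hp)
      rwa [sref_neg] at this
  refine Subgroup.closure_induction ?_ ?_ ?_ ?_ hmem
  · rintro _ ⟨α, hα, rfl⟩
    exact ⟨[α], by simpa using hα, by simp⟩
  · exact ⟨[], by simp, by simp⟩
  · rintro _ _ _ _ ⟨l, hl, rfl⟩ ⟨m, hm, rfl⟩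
    refine ⟨l ++ m, fun α hα => ?_, by simp⟩
    rcases List.mem_append.1 hα with h1 | h1
    exacts [hl _ h1, hm _ h1]
  · rintro _ _ ⟨l, hl, rfl⟩
    refine ⟨l.reverse, fun α hα => hl _ (List.mem_reverse.1 hα), ?_⟩
    rw [List.prod_inv_reverse, List.map_reverse, List.map_map]
    exact congrArg (fun m => (List.reverse m).prod)
      (List.map_congr_left fun α _ => (sref_inv α).symm)

theorem word_mem_sig (h : IsPosRoots Sig Sp v) (l : List (E d)) (hl : ∀ α ∈ l, IsSimple Sp α)
    {β : E d} (hβ : β ∈ Sig) : (l.map sref).prod β ∈ Sig := by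
  induction l with
  | nil => exact hβ
  | cons a l ih =>
    rw [List.map_cons, List.prod_cons, LinearIsometryEquiv.coe_mul, Function.comp_apply]
    exact h.sref_mem_sig (h.mem_sig (hl a (by simp)).1)
      (ih (fun α hα => hl α (List.mem_cons_of_mem a hα)))

/-- The exchange property. -/
theorem exchange (h : IsPosRoots Sig Sp v) {α : E d} (hα : IsSimple Sp α) (l : List (E d))
    (hl : ∀ a ∈ l, IsSimple Sp a) (hn : -((l.map sref).prod α) ∈ Sp) :
    ∃ l' : List (E d), (∀ a ∈ l', IsSimple Sp a) ∧ l'.length + 1 = l.length ∧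
      (l'.map sref).prod = (l.map sref).prod * sref α := by
  induction l with
  | nil => exact absurd hn (h.neg_notMem hα.1)
  | cons a l ih =>
    have hl' : ∀ b ∈ l, IsSimple Sp b := fun b hb => hl b (List.mem_cons_of_mem a hb)
    by_cases hc : (l.map sref).prod α ∈ Sp
    · have ha : IsSimple Sp a := hl a (by simp)
      have he : (l.map sref).prod α = a := by
        by_contra hne
        rw [List.map_cons, List.prod_cons, LinearIsometryEquiv.coe_mul, Function.comp_apply] at hn
        exact h.neg_notMem (ha.2 _ hc hne) hn
      refine ⟨l, hl', by simp, ?_⟩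
      have h1 : sref a = (l.map sref).prod * sref α * ((l.map sref).prod)⁻¹ := by
        rw [← sref_conj, he]
      rw [List.map_cons, List.prod_cons, h1]
      simp [mul_assoc, sref_mul_self]
    · obtain ⟨l', h1, h2, h3⟩ := ih hl'
        (h.neg_mem_of_notMem (h.word_mem_sig l hl' (h.mem_sig hα.1)) hc)
      refine ⟨a :: l', fun b hb => ?_, by simp [h2], by simp [h3, mul_assoc]⟩
      rcases List.mem_cons.1 hb with rfl | hb
      · exact hl b (by simp)
      · exact h1 b hb

theorem word_eq_one (h : IsPosRoots Sig Sp v) (n : ℕ) : ∀ l : List (E d), l.length = n →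
    (∀ a ∈ l, IsSimple Sp a) → (l.map sref).prod (∑ α ∈ Sp, α) = ∑ α ∈ Sp, α →
      (l.map sref).prod = 1 := by
  induction n using Nat.strong_induction_on with
  | _ n ih =>
    intro l hln hl hfix
    rcases List.eq_nil_or_concat l with rfl | ⟨m, α, rfl⟩
    · simp
    have hα : IsSimple Sp α := hl α (by simp)
    have hm : ∀ a ∈ m, IsSimple Sp a := fun a ha => hl a (by simp [ha])
    have hprod : ((m.concat α).map sref).prod = (m.map sref).prod * sref α := by simp
    have hneg : ((m.concat α).map sref).prod α = -((m.map sref).prod α) := by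
      rw [hprod, LinearIsometryEquiv.coe_mul, Function.comp_apply, sref_self (h.ne_zero hα.1),
        map_neg]
    have hmem : -((m.map sref).prod α) ∈ Sp := by
      rw [← hneg]
      have hpos : 0 < ⟪((m.concat α).map sref).prod α, ∑ α ∈ Sp, α⟫ := by
        rw [← hfix, LinearIsometryEquiv.inner_map_map]
        exact h.inner_rho_pos α hα.1
      by_contra hn
      have := h.inner_rho_pos _ (h.neg_mem_of_notMem
        (h.word_mem_sig _ hl (h.mem_sig hα.1)) hn)
      rw [inner_neg_left] at this
      linarith
    obtain ⟨l', h1, h2, h3⟩ := h.exchange hα m hm hmem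
    rw [hprod, ← h3]
    refine ih l'.length ?_ l' rfl h1 ?_
    · rw [← hln, List.length_concat]
      omega
    · rw [h3, ← hprod, hfix]

theorem eq_one_of_fix_rho (h : IsPosRoots Sig Sp v) {w : E d ≃ₗᵢ[ℝ] E d}
    (hw : w ∈ weylGroup Sig) (hfix : w (∑ α ∈ Sp, α) = ∑ α ∈ Sp, α) : w = 1 := by
  obtain ⟨l, hl, rfl⟩ := h.exists_simple_word hw
  exact h.word_eq_one _ l rfl hl hfix

theorem dsign_mul_self (h : IsPosRoots Sig Sp v) {w : E d ≃ₗᵢ[ℝ] E d} (hw : w ∈ weylGroup Sig) :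
    dsign w * dsign w = 1 := by
  obtain ⟨l, hl, rfl⟩ := h.exists_simple_word hw
  clear hw
  induction l with
  | nil => simp [dsign_one]
  | cons a l ih =>
    rw [List.map_cons, List.prod_cons, dsign_mul, dsign_sref (h.ne_zero (hl a (by simp)).1)]
    linear_combination ih fun b hb => hl b (List.mem_cons_of_mem a hb)

end IsPosRoots

/-- The product side of the Weyl denominator formula. -/
def weylDenom {d : ℕ} (Sp : Finset (E d)) (Z : E d) : ℝ :=
  ∏ α ∈ Sp, (Real.exp ⟪α, Z⟫ - Real.exp (-⟪α, Z⟫))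

/-- The alternating exponential sum over the Weyl group with weight `μ`. -/
def altExp {d : ℕ} (Sig : Finset (E d)) [Fintype ↥(weylGroup Sig)] (μ Z : E d) : ℝ :=
  ∑ w : ↥(weylGroup Sig), dsign w.1 * Real.exp ⟪μ, w.1 Z⟫

/-- The weight `∑ Sp - 2 ∑ T`. -/
def weightOf {d : ℕ} (Sp T : Finset (E d)) : E d := (∑ α ∈ Sp, α) - (2 : ℝ) • ∑ α ∈ T, α

theorem weightOf_empty {d : ℕ} (Sp : Finset (E d)) : weightOf Sp ∅ = ∑ α ∈ Sp, α := by
  simp [weightOf]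

theorem weylDenom_eq_sum {d : ℕ} (Sp : Finset (E d)) (Z : E d) :
    weylDenom Sp Z = ∑ T ∈ Sp.powerset, (-1) ^ #T * Real.exp ⟪weightOf Sp T, Z⟫ := by
  rw [weylDenom, prod_sub]
  refine sum_congr rfl fun T hT => ?_
  rw [mul_assoc, ← Real.exp_sum, ← Real.exp_sum, ← Real.exp_add, weightOf, inner_sub_left,
    inner_smul_left, sum_inner, sum_inner, sum_neg_distrib, ← sum_sdiff (mem_powerset.1 hT)]
  simp only [conj_trivial]
  ring_nf

theorem altExp_apply {d : ℕ} {Sig : Finset (E d)} [Fintype ↥(weylGroup Sig)]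
    {u : E d ≃ₗᵢ[ℝ] E d} (hu : u ∈ weylGroup Sig) (μ Z : E d) :
    altExp Sig (u μ) Z = dsign u * altExp Sig μ Z := by
  rw [altExp, altExp, mul_sum, ← Equiv.sum_comp (Equiv.mulLeft (⟨u, hu⟩ : ↥(weylGroup Sig)))]
  refine sum_congr rfl fun w _ => ?_
  have h1 : ((Equiv.mulLeft (⟨u, hu⟩ : ↥(weylGroup Sig)) w : ↥(weylGroup Sig)) :
      E d ≃ₗᵢ[ℝ] E d) = u * w.1 := rfl
  rw [h1, dsign_mul, LinearIsometryEquiv.coe_mul, Function.comp_apply, u.inner_map_map, mul_assoc]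

namespace IsPosRoots

variable {d : ℕ} {Sig Sp : Finset (E d)} {v : E d}

theorem weylDenom_sref (h : IsPosRoots Sig Sp v) {α : E d} (hα : IsSimple Sp α) (Z : E d) :
    weylDenom Sp (sref α Z) = -weylDenom Sp Z := by
  have h1 : ∀ β : E d, ⟪β, sref α Z⟫ = ⟪sref α β, Z⟫ := fun β => by
    rw [inner_left_eq_inner_inv, sref_inv]
  simp only [weylDenom, h1]
  rw [← mul_prod_erase Sp _ hα.1, ← mul_prod_erase Sp _ hα.1,
    h.prod_erase_sref hα fun β => Real.exp ⟪β, Z⟫ - Real.exp (-⟪β, Z⟫),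
    sref_self (h.ne_zero hα.1), inner_neg_left, neg_neg]
  ring

theorem weylDenom_apply (h : IsPosRoots Sig Sp v) {w : E d ≃ₗᵢ[ℝ] E d} (hw : w ∈ weylGroup Sig)
    (Z : E d) : weylDenom Sp (w Z) = dsign w * weylDenom Sp Z := by
  obtain ⟨l, hl, rfl⟩ := h.exists_simple_word hw
  clear hw
  induction l with
  | nil => simp [dsign_one]
  | cons a l ih =>
    have ha := hl a (by simp)
    rw [List.map_cons, List.prod_cons, dsign_mul, dsign_sref (h.ne_zero ha.1),
      LinearIsometryEquiv.coe_mul, Function.comp_apply, h.weylDenom_sref ha,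
      ih fun b hb => hl b (List.mem_cons_of_mem a hb)]
    ring

theorem sref_weightOf (h : IsPosRoots Sig Sp v) {α : E d} (hα : IsSimple Sp α) {T : Finset (E d)}
    (hT : T ⊆ Sp) : ∃ T' ⊆ Sp, sref α (weightOf Sp T) = weightOf Sp T' := by
  have hinj : Set.InjOn (sref α) (T.erase α : Finset (E d)) := (sref α).injective.injOn
  have hsub : (T.erase α).image (sref α) ⊆ Sp.erase α := by
    intro β hβ
    obtain ⟨γ, hγ, rfl⟩ := mem_image.1 hβ
    exact h.sref_mem_erase hα (erase_subset_erase α hT hγ)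
  have hsum : ∑ β ∈ (T.erase α).image (sref α), β = sref α (∑ β ∈ T.erase α, β) := by
    rw [sum_image hinj, map_sum]
  by_cases hmem : α ∈ T
  · refine ⟨_, hsub.trans (erase_subset _ _), ?_⟩
    rw [weightOf, weightOf, hsum, map_sub, map_smul, h.sref_rho hα, ← add_sum_erase T _ hmem,
      map_add, sref_self (h.ne_zero hα.1)]
    module
  · refine ⟨insert α ((T.erase α).image (sref α)),
      insert_subset hα.1 (hsub.trans (erase_subset _ _)), ?_⟩
    rw [weightOf, weightOf, sum_insert fun hm => (mem_erase.1 (hsub hm)).1 rfl, hsum, map_sub,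
      map_smul, h.sref_rho hα, erase_eq_of_notMem hmem]
    module

theorem apply_weightOf (h : IsPosRoots Sig Sp v) {w : E d ≃ₗᵢ[ℝ] E d} (hw : w ∈ weylGroup Sig)
    {T : Finset (E d)} (hT : T ⊆ Sp) : ∃ T' ⊆ Sp, w (weightOf Sp T) = weightOf Sp T' := by
  obtain ⟨l, hl, rfl⟩ := h.exists_simple_word hw
  clear hw
  induction l with
  | nil => exact ⟨T, hT, rfl⟩
  | cons a l ih =>
    obtain ⟨T', hT', he⟩ := ih fun b hb => hl b (List.mem_cons_of_mem a hb)
    rw [List.map_cons, List.prod_cons, LinearIsometryEquiv.coe_mul, Function.comp_apply, he]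
    exact h.sref_weightOf (hl a (by simp)) hT'

theorem weightOf_eq_rho (h : IsPosRoots Sig Sp v) {T : Finset (E d)} (hT : T ⊆ Sp)
    (hpos : ∀ α, IsSimple Sp α → 0 < ⟪α, weightOf Sp T⟫) : weightOf Sp T = ∑ α ∈ Sp, α := by
  have h1 : ∀ α ∈ Sp, ⟪α, ∑ β ∈ T, β⟫ ≤ 0 := by
    refine h.induction_on (fun α hα => ?_) fun β _ γ _ h1 h2 => ?_
    · have hα0 : 0 < ⟪α, α⟫ := real_inner_self_pos.2 (h.ne_zero hα.1)
      obtain ⟨n, hn⟩ : ∃ n : ℤ, 2 * ⟪α, ∑ β ∈ T, β⟫ / ⟪α, α⟫ = n := by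
        choose! z hz using fun β (hβ : β ∈ T) =>
          h.crys β (h.mem_sig (hT hβ)) α (h.mem_sig hα.1)
        refine ⟨∑ β ∈ T, z β, ?_⟩
        rw [inner_sum, mul_sum, sum_div, Int.cast_sum]
        refine sum_congr rfl fun β hβ => ?_
        rw [← hz β hβ, real_inner_comm]
      have h2 := hpos α hα
      rw [weightOf, inner_sub_right, inner_smul_right, h.inner_simple_rho hα] at h2
      rw [div_eq_iff hα0.ne'] at hn
      have h3 : (n : ℝ) < 1 := by
        by_contra! h4
        nlinarith
      have h4 : n ≤ 0 := by
        have : n < 1 := by exact_mod_cast h3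
        omega
      have h5 : (n : ℝ) ≤ 0 := by exact_mod_cast h4
      nlinarith
    · rw [inner_add_left]
      exact add_nonpos h1 h2
  have h2 : ⟪∑ β ∈ T, β, ∑ β ∈ T, β⟫ ≤ 0 := by
    conv_lhs => rw [sum_inner]
    exact sum_nonpos fun β hβ => h1 β (hT hβ)
  rw [weightOf, real_inner_self_nonpos.1 h2, smul_zero, sub_zero]

theorem inner_rho_apply_lt (h : IsPosRoots Sig Sp v) {w : E d ≃ₗᵢ[ℝ] E d}
    (hw : w ∈ weylGroup Sig) (hne : w ≠ 1) :
    ⟪∑ α ∈ Sp, α, w v⟫ < ⟪∑ α ∈ Sp, α, v⟫ := by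
  obtain ⟨T, hT, he⟩ := h.apply_weightOf (inv_mem hw) (empty_subset Sp)
  rw [weightOf_empty] at he
  have hTne : T.Nonempty := by
    rw [nonempty_iff_ne_empty]
    rintro rfl
    rw [weightOf_empty] at he
    exact hne (inv_eq_one.1 (h.eq_one_of_fix_rho (inv_mem hw) he))
  have h1 := inner_left_eq_inner_inv w⁻¹ (∑ α ∈ Sp, α) v
  rw [inv_inv, he] at h1
  rw [← h1, weightOf, inner_sub_left, inner_smul_left, sum_inner T]
  have h2 : 0 < ∑ β ∈ T, ⟪β, v⟫ := sum_pos (fun β hβ => h.height_pos (hT hβ)) hTne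
  simp only [conj_trivial]
  linarith

variable [Fintype ↥(weylGroup Sig)]

theorem card_mul_weylDenom (h : IsPosRoots Sig Sp v) (Z : E d) :
    Fintype.card ↥(weylGroup Sig) * weylDenom Sp Z =
      ∑ T ∈ Sp.powerset, (-1) ^ #T * altExp Sig (weightOf Sp T) Z := by
  have h1 : ∀ w : ↥(weylGroup Sig), dsign w.1 * weylDenom Sp (w.1 Z) = weylDenom Sp Z := fun w => by
    rw [h.weylDenom_apply w.2, ← mul_assoc, h.dsign_mul_self w.2, one_mul]
  have h2 : ∑ w : ↥(weylGroup Sig), dsign w.1 * weylDenom Sp (w.1 Z) =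
      Fintype.card ↥(weylGroup Sig) * weylDenom Sp Z := by
    simp [h1]
  rw [← h2]
  simp only [weylDenom_eq_sum, altExp, mul_sum]
  rw [sum_comm]
  refine sum_congr rfl fun T _ => sum_congr rfl fun w _ => ?_
  ring

theorem exists_dominant (h : IsPosRoots Sig Sp v) {T : Finset (E d)} (hT : T ⊆ Sp) :
    ∃ u ∈ weylGroup Sig, ∃ T' ⊆ Sp, u (weightOf Sp T) = weightOf Sp T' ∧
      ∀ α, IsSimple Sp α → 0 ≤ ⟪α, weightOf Sp T'⟫ := by
  obtain ⟨u, -, hu⟩ := exists_max_image (univ : Finset ↥(weylGroup Sig))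
    (fun u => ⟪u.1 (weightOf Sp T), v⟫) univ_nonempty
  obtain ⟨T', hT', he⟩ := h.apply_weightOf u.2 hT
  refine ⟨u.1, u.2, T', hT', he, fun α hα => ?_⟩
  have h1 := hu (⟨sref α, sref_mem_weylGroup (h.mem_sig hα.1)⟩ * u) (mem_univ _)
  have h2 : ((⟨sref α, sref_mem_weylGroup (h.mem_sig hα.1)⟩ * u : ↥(weylGroup Sig)) :
      E d ≃ₗᵢ[ℝ] E d) = sref α * u.1 := rfl
  rw [h2, LinearIsometryEquiv.coe_mul, Function.comp_apply, he, sref_apply, reflVec,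
    inner_sub_left, inner_smul_left, conj_trivial] at h1
  by_contra! hneg
  have h3 : 2 * ⟪α, weightOf Sp T'⟫ / ⟪α, α⟫ < 0 :=
    div_neg_of_neg_of_pos (by linarith) (real_inner_self_pos.2 (h.ne_zero hα.1))
  have h4 := mul_neg_of_neg_of_pos h3 (h.height_pos hα.1)
  linarith

theorem exists_altExp_weightOf (h : IsPosRoots Sig Sp v) {T : Finset (E d)} (hT : T ⊆ Sp) :
    ∃ c : ℝ, ∀ Z, altExp Sig (weightOf Sp T) Z = c * altExp Sig (∑ α ∈ Sp, α) Z := by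
  obtain ⟨u, hu, T', hT', he, hdom⟩ := h.exists_dominant hT
  have hu2 := h.dsign_mul_self hu
  have h1 : ∀ Z, altExp Sig (weightOf Sp T) Z = dsign u * altExp Sig (weightOf Sp T') Z :=
    fun Z => by rw [← he, altExp_apply hu, ← mul_assoc, hu2, one_mul]
  by_cases hpos : ∀ α, IsSimple Sp α → 0 < ⟪α, weightOf Sp T'⟫
  · exact ⟨dsign u, fun Z => by rw [h1, h.weightOf_eq_rho hT' hpos]⟩
  · push Not at hpos
    obtain ⟨α, hα, hle⟩ := hpos
    have h2 : sref α (weightOf Sp T') = weightOf Sp T' :=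
      sref_eq_self_of_inner_eq_zero (le_antisymm hle (hdom α hα))
    refine ⟨0, fun Z => ?_⟩
    have h3 := altExp_apply (sref_mem_weylGroup (h.mem_sig hα.1)) (weightOf Sp T') Z
    rw [h2, dsign_sref (h.ne_zero hα.1)] at h3
    rw [h1, show altExp Sig (weightOf Sp T') Z = 0 by linarith]
    ring

/-- The Weyl denominator formula. -/
theorem altExp_rho (h : IsPosRoots Sig Sp v) (Z : E d) :
    altExp Sig (∑ α ∈ Sp, α) Z = weylDenom Sp Z := by
  obtain ⟨C, hC⟩ : ∃ C : ℝ, ∀ Z, Fintype.card ↥(weylGroup Sig) * weylDenom Sp Z =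
      C * altExp Sig (∑ α ∈ Sp, α) Z := by
    choose! c hc using fun T (hT : T ⊆ Sp) => h.exists_altExp_weightOf hT
    refine ⟨∑ T ∈ Sp.powerset, (-1) ^ #T * c T, fun Z => ?_⟩
    rw [h.card_mul_weylDenom, sum_mul]
    refine sum_congr rfl fun T hT => ?_
    rw [hc T (mem_powerset.1 hT), mul_assoc]
  have hB : Filter.Tendsto (fun τ : ℝ => Real.exp (-(τ * ⟪∑ α ∈ Sp, α, v⟫)) *
      weylDenom Sp (τ • v)) Filter.atTop (nhds 1) := by
    have h1 : ∀ τ : ℝ, Real.exp (-(τ * ⟪∑ α ∈ Sp, α, v⟫)) * weylDenom Sp (τ • v) =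
        ∏ α ∈ Sp, (1 - Real.exp (τ * (-2 * ⟪α, v⟫))) := fun τ => by
      rw [weylDenom, sum_inner, mul_sum, ← sum_neg_distrib, Real.exp_sum, ← prod_mul_distrib]
      refine prod_congr rfl fun α _ => ?_
      rw [inner_smul_right, mul_sub, ← Real.exp_add, ← Real.exp_add]
      ring_nf
      simp
    simp only [h1]
    rw [show nhds (1 : ℝ) = nhds (∏ α ∈ Sp, (1 - 0)) by simp]
    refine tendsto_finsetProd _ fun α hα => tendsto_const_nhds.sub
      (Real.tendsto_exp_atBot.comp (Filter.tendsto_id.atTop_mul_const_of_neg ?_))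
    have := h.height_pos hα
    linarith
  have hF : Filter.Tendsto (fun τ : ℝ => Real.exp (-(τ * ⟪∑ α ∈ Sp, α, v⟫)) *
      altExp Sig (∑ α ∈ Sp, α) (τ • v)) Filter.atTop (nhds 1) := by
    have h1 : ∀ τ : ℝ, Real.exp (-(τ * ⟪∑ α ∈ Sp, α, v⟫)) *
        altExp Sig (∑ α ∈ Sp, α) (τ • v) = ∑ w : ↥(weylGroup Sig), dsign w.1 *
          Real.exp (τ * (⟪∑ α ∈ Sp, α, w.1 v⟫ - ⟪∑ α ∈ Sp, α, v⟫)) := fun τ => by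
      rw [altExp, mul_sum]
      refine sum_congr rfl fun w _ => ?_
      rw [map_smul, inner_smul_right, mul_left_comm, ← Real.exp_add]
      ring_nf
    simp only [h1]
    rw [show nhds (1 : ℝ) = nhds (∑ w : ↥(weylGroup Sig), if w = 1 then 1 else 0) by simp]
    refine tendsto_finsetSum _ fun w _ => ?_
    by_cases hw : w = 1
    · subst hw
      simp [dsign_one]
    · rw [if_neg hw, ← mul_zero (dsign w.1)]
      refine tendsto_const_nhds.mul
        (Real.tendsto_exp_atBot.comp (Filter.tendsto_id.atTop_mul_const_of_neg ?_))
      have := h.inner_rho_apply_lt w.2 fun h1 => hw (Subtype.ext h1)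
      linarith
  have hlim := tendsto_nhds_unique ((hB.const_mul (Fintype.card ↥(weylGroup Sig) : ℝ)).congr
    fun τ => by rw [mul_left_comm, hC, mul_left_comm]) (hF.const_mul C)
  rw [mul_one, mul_one] at hlim
  have h1 := hC Z
  rw [← hlim] at h1
  have h2 : (Fintype.card ↥(weylGroup Sig) : ℝ) ≠ 0 := Nat.cast_ne_zero.2 Fintype.card_ne_zero
  exact (mul_left_cancel₀ h2 h1).symm

end IsPosRoots

theorem exists_inner_eq_zero_inner_ne_zero {d : ℕ} {α β : E d} (hβ : β ≠ 0)
    (h : ∀ t : ℝ, α ≠ t • β) : ∃ x : E d, ⟪β, x⟫ = 0 ∧ ⟪α, x⟫ ≠ 0 := by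
  have hβ0 : ⟪β, β⟫ ≠ 0 := by simpa using hβ
  have h1 : ⟪β, α - (⟪β, α⟫ / ⟪β, β⟫) • β⟫ = 0 := by
    rw [inner_sub_right, inner_smul_right, div_mul_cancel₀ _ hβ0, sub_self]
  refine ⟨_, h1, fun h2 => h (⟪β, α⟫ / ⟪β, β⟫) (sub_eq_zero.1 ?_)⟩
  rw [← inner_self_eq_zero (𝕜 := ℝ)]
  conv_lhs => rw [inner_sub_left, inner_smul_left, h1, h2]
  simp

theorem dense_setOf_prod_ne_zero {V ι : Type*} [NormedAddCommGroup V] [NormedSpace ℝ V]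
    (l : ι → V →L[ℝ] ℝ) (s : Finset ι) (hl : ∀ i ∈ s, l i ≠ 0) :
    Dense {x : V | ∏ i ∈ s, l i x ≠ 0} := by
  induction s using Finset.induction_on with
  | empty => simp
  | insert i s hi ih =>
    have h1 : {x : V | ∏ j ∈ insert i s, l j x ≠ 0} =
        ((l i).ker : Set V)ᶜ ∩ {x : V | ∏ j ∈ s, l j x ≠ 0} := by
      ext x
      simp [prod_insert hi]
    rw [h1]
    refine Dense.inter_of_isOpen_left ?_ (ih fun j hj => hl j (mem_insert_of_mem hj))
      (l i).isClosed_ker.isOpen_compl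
    rw [← interior_eq_empty_iff_dense_compl]
    by_contra hne
    have h2 := Submodule.eq_top_of_nonempty_interior' _ (Set.nonempty_iff_ne_empty.2 hne)
    exact hl i (mem_insert_self i s) (ContinuousLinearMap.ext fun x => by
      have : x ∈ (l i).ker := by rw [h2]; trivial
      exact this)

theorem continuous_piP {d : ℕ} (Sp : Finset (E d)) : Continuous (piP Sp) := by
  unfold piP
  fun_prop

theorem piP_smul {d : ℕ} (Sp : Finset (E d)) (t : ℝ) (X : E d) :
    piP Sp (t • X) = t ^ #Sp * piP Sp X := by
  simp only [piP, inner_smul_right, prod_mul_distrib, prod_const]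

/-- The functionals `(X, Y) ↦ ⟪α, X⟫` and `(X, Y) ↦ ⟪α, Y⟫` on the product space. -/
def rootFunctional {d : ℕ} : E d ⊕ E d → E d × E d →L[ℝ] ℝ :=
  Sum.elim (fun α => (innerSL ℝ α).comp (ContinuousLinearMap.fst ℝ (E d) (E d)))
    (fun α => (innerSL ℝ α).comp (ContinuousLinearMap.snd ℝ (E d) (E d)))

theorem rootFunctional_inl {d : ℕ} (α : E d) (p : E d × E d) :
    rootFunctional (Sum.inl α) p = ⟪α, p.1⟫ := rfl

theorem rootFunctional_inr {d : ℕ} (α : E d) (p : E d × E d) :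
    rootFunctional (Sum.inr α) p = ⟪α, p.2⟫ := rfl

theorem prod_rootFunctional {d : ℕ} (Sp : Finset (E d)) (p : E d × E d) :
    ∏ i ∈ Sp.disjSum Sp, rootFunctional i p = piP Sp p.1 * piP Sp p.2 := by
  rw [prod_disjSum]
  rfl

theorem zero_prod_mem_Dset {d : ℕ} {Sig : Finset (E d)} {Y : E d} (hY : Y ≠ 0) :
    ((0 : E d), Y) ∈ Dset Sig := by
  intro w h
  exact hY ((map_eq_zero_iff w.1 w.1.injective).1 h.symm)

/-- The alternating sum of Riesz kernels `∑ w, det w * ‖X - w Y‖ ^ (-d)`. -/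
def altKernel {d : ℕ} (Sig : Finset (E d)) [Fintype ↥(weylGroup Sig)] (p : E d × E d) : ℝ :=
  ∑ w : ↥(weylGroup Sig), dsign w.1 * ‖p.1 - w.1 p.2‖ ^ (-(d : ℝ))

section altKernel

variable {d : ℕ} {Sig : Finset (E d)} [Fintype ↥(weylGroup Sig)]

theorem isOpen_Dset : IsOpen (Dset Sig) := by
  have h1 : Dset Sig = ⋂ w : ↥(weylGroup Sig), {p : E d × E d | p.1 ≠ w.1 p.2} := by
    ext p
    simp [Dset]
  rw [h1]
  exact isOpen_iInter_of_finite fun w =>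
    isOpen_ne_fun continuous_fst (w.1.continuous.comp continuous_snd)

theorem altKernel_apply_left {u : E d ≃ₗᵢ[ℝ] E d} (hu : u ∈ weylGroup Sig) (X Y : E d) :
    altKernel Sig (u X, Y) = dsign u * altKernel Sig (X, Y) := by
  rw [altKernel, altKernel, mul_sum, ← Equiv.sum_comp (Equiv.mulLeft (⟨u, hu⟩ : ↥(weylGroup Sig)))]
  refine sum_congr rfl fun w _ => ?_
  have h1 : ((Equiv.mulLeft (⟨u, hu⟩ : ↥(weylGroup Sig)) w : ↥(weylGroup Sig)) :
      E d ≃ₗᵢ[ℝ] E d) = u * w.1 := rfl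
  rw [h1, dsign_mul, LinearIsometryEquiv.coe_mul, Function.comp_apply, mul_assoc]
  dsimp only
  rw [← map_sub, u.norm_map]

theorem altKernel_apply_right {u : E d ≃ₗᵢ[ℝ] E d} (hu : u ∈ weylGroup Sig) (X Y : E d) :
    dsign u * altKernel Sig (X, u Y) = altKernel Sig (X, Y) := by
  rw [altKernel, altKernel, mul_sum,
    ← Equiv.sum_comp (Equiv.mulRight (⟨u, hu⟩ : ↥(weylGroup Sig))) fun w : ↥(weylGroup Sig) =>
      dsign w.1 * ‖X - w.1 Y‖ ^ (-(d : ℝ))]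
  refine sum_congr rfl fun w _ => ?_
  have h1 : ((Equiv.mulRight (⟨u, hu⟩ : ↥(weylGroup Sig)) w : ↥(weylGroup Sig)) :
      E d ≃ₗᵢ[ℝ] E d) = w.1 * u := rfl
  rw [h1, dsign_mul, LinearIsometryEquiv.coe_mul, Function.comp_apply]
  ring

theorem contDiffAt_altKernel {p : E d × E d} (hp : p ∈ Dset Sig) :
    ContDiffAt ℝ (⊤ : ℕ∞) (altKernel Sig) p := by
  unfold altKernel
  refine ContDiffAt.sum fun w _ => contDiffAt_const.mul ?_
  have h1 : p.1 - w.1 p.2 ≠ 0 := sub_ne_zero.2 (hp w)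
  have h2 : ContDiffAt ℝ (⊤ : ℕ∞) (fun q : E d × E d => q.1 - w.1 q.2) p :=
    contDiffAt_fst.sub (w.1.contDiff.contDiffAt.comp p contDiffAt_snd)
  exact (h2.norm ℝ h1).rpow_const_of_ne (norm_ne_zero_iff.2 h1)

end altKernel

namespace IsPosRoots

variable {d : ℕ} {Sig Sp : Finset (E d)} {v : E d}

theorem piP_rho_pos (h : IsPosRoots Sig Sp v) : 0 < piP Sp (∑ α ∈ Sp, α) :=
  prod_pos h.inner_rho_pos

theorem not_proportional (h : IsPosRoots Sig Sp v) {α β : E d} (hα : α ∈ Sp) (hβ : β ∈ Sp)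
    (hne : α ≠ β) (t : ℝ) : α ≠ t • β := by
  intro he
  rcases h.root.2.2.1 β (h.mem_sig hβ) t (he ▸ h.mem_sig hα) with rfl | rfl
  · exact hne (by rw [he, one_smul])
  · exact h.neg_notMem hβ (by rwa [← neg_one_smul ℝ β, ← he])

theorem rootFunctional_ne_zero (h : IsPosRoots Sig Sp v) :
    ∀ i ∈ Sp.disjSum Sp, rootFunctional i ≠ 0 := by
  rintro (α | α) hi h0
  · have hα := inl_mem_disjSum.1 hi
    have h1 := rootFunctional_inl α (α, 0)
    rw [h0] at h1
    exact h.ne_zero hα (inner_self_eq_zero.1 h1.symm)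
  · have hα := inr_mem_disjSum.1 hi
    have h1 := rootFunctional_inr α (0, α)
    rw [h0] at h1
    exact h.ne_zero hα (inner_self_eq_zero.1 h1.symm)

theorem rootFunctional_independent (h : IsPosRoots Sig Sp v) :
    ∀ i ∈ Sp.disjSum Sp, ∀ j ∈ Sp.disjSum Sp, i ≠ j →
      ∃ u, rootFunctional j u = 0 ∧ rootFunctional i u ≠ 0 := by
  rintro (α | α) hi (β | β) hj hne
  · have hα := inl_mem_disjSum.1 hi
    have hβ := inl_mem_disjSum.1 hj
    obtain ⟨x, h1, h2⟩ := exists_inner_eq_zero_inner_ne_zero (h.ne_zero hβ)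
      (h.not_proportional hα hβ fun he => hne (he ▸ rfl))
    exact ⟨(x, 0), h1, h2⟩
  · have hα := inl_mem_disjSum.1 hi
    exact ⟨(α, 0), inner_zero_right β, fun h0 => h.ne_zero hα (inner_self_eq_zero.1 h0)⟩
  · have hα := inr_mem_disjSum.1 hi
    exact ⟨(0, α), inner_zero_right β, fun h0 => h.ne_zero hα (inner_self_eq_zero.1 h0)⟩
  · have hα := inr_mem_disjSum.1 hi
    have hβ := inr_mem_disjSum.1 hj
    obtain ⟨x, h1, h2⟩ := exists_inner_eq_zero_inner_ne_zero (h.ne_zero hβ)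
      (h.not_proportional hα hβ fun he => hne (he ▸ rfl))
    exact ⟨(0, x), h1, h2⟩

theorem dense_regular (h : IsPosRoots Sig Sp v) :
    Dense {p : E d × E d | piP Sp p.1 * piP Sp p.2 ≠ 0} := by
  simpa only [prod_rootFunctional] using
    dense_setOf_prod_ne_zero rootFunctional (Sp.disjSum Sp) h.rootFunctional_ne_zero

theorem dense_piP_ne_zero (h : IsPosRoots Sig Sp v) : Dense {Y : E d | piP Sp Y ≠ 0} := by
  refine dense_setOf_prod_ne_zero (fun α => innerSL ℝ α) Sp fun α hα h0 => ?_
  have h1 : innerSL ℝ α α = 0 := by rw [h0]; rfl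
  exact h.ne_zero hα (inner_self_eq_zero.1 h1)

variable [Fintype ↥(weylGroup Sig)]

theorem altKernel_eq_zero (h : IsPosRoots Sig Sp v) :
    ∀ i ∈ Sp.disjSum Sp, ∀ p, rootFunctional i p = 0 → altKernel Sig p = 0 := by
  rintro (α | α) hi ⟨X, Y⟩ h0
  · have hα := inl_mem_disjSum.1 hi
    have h1 := altKernel_apply_left (sref_mem_weylGroup (h.mem_sig hα)) X Y
    rw [sref_eq_self_of_inner_eq_zero (show ⟪α, X⟫ = 0 from h0), dsign_sref (h.ne_zero hα)] at h1
    linarith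
  · have hα := inr_mem_disjSum.1 hi
    have h1 := altKernel_apply_right (sref_mem_weylGroup (h.mem_sig hα)) X Y
    rw [sref_eq_self_of_inner_eq_zero (show ⟪α, Y⟫ = 0 from h0), dsign_sref (h.ne_zero hα)] at h1
    linarith

theorem exists_altKernel_eq_mul (h : IsPosRoots Sig Sp v) {p₀ : E d × E d} (hp : p₀ ∈ Dset Sig) :
    ∃ G : E d × E d → ℝ, Continuous G ∧
      ∀ᶠ p in nhds p₀, altKernel Sig p = piP Sp p.1 * piP Sp p.2 * G p := by
  obtain ⟨r, hr, hsub⟩ := Metric.nhds_basis_closedBall.mem_iff.1 (isOpen_Dset.mem_nhds hp)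
  let χ : ContDiffBump p₀ := ⟨r / 2, r, by positivity, by linarith⟩
  have hsm : ContDiff ℝ (⊤ : ℕ∞) fun p => χ p * altKernel Sig p := by
    refine contDiff_iff_contDiffAt.2 fun p => ?_
    by_cases hp : p ∈ tsupport χ
    · rw [χ.tsupport_eq] at hp
      exact χ.contDiff.contDiffAt.mul (contDiffAt_altKernel (hsub hp))
    · refine (contDiffAt_const (c := (0 : ℝ))).congr_of_eventuallyEq ?_
      filter_upwards [notMem_tsupport_iff_eventuallyEq.1 hp] with q hq
      rw [hq, Pi.zero_apply, zero_mul]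
  obtain ⟨G, hG, hfac⟩ := hsm.exists_eq_prod_linear_mul rootFunctional (Sp.disjSum Sp)
    h.rootFunctional_ne_zero h.rootFunctional_independent _ fun i hi p h0 => by
      rw [h.altKernel_eq_zero i hi p h0, mul_zero]
  refine ⟨G, hG.continuous, ?_⟩
  filter_upwards [χ.eventuallyEq_one] with p hp1
  have h1 := hfac p
  rwa [hp1, Pi.one_apply, one_mul, prod_rootFunctional] at h1

theorem alternating_moments (h : IsPosRoots Sig Sp v) (Y : E d) :
    (∀ k < #Sp, ∑ w : ↥(weylGroup Sig), dsign w.1 * ⟪∑ α ∈ Sp, α, w.1 Y⟫ ^ k = 0) ∧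
      ∑ w : ↥(weylGroup Sig), dsign w.1 * ⟪∑ α ∈ Sp, α, w.1 Y⟫ ^ #Sp =
        (#Sp).factorial * (2 ^ #Sp * piP Sp Y) := by
  refine moments_of_tendsto_sum_exp _ _ _ _ ?_
  have h1 : ∀ t : ℝ, (∑ w : ↥(weylGroup Sig), dsign w.1 *
      Real.exp (t * ⟪∑ α ∈ Sp, α, w.1 Y⟫)) / t ^ #Sp =
      ∏ α ∈ Sp, (Real.exp (t * ⟪α, Y⟫) - Real.exp (-(t * ⟪α, Y⟫))) / t := fun t => by
    have h2 := h.altExp_rho (t • Y)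
    simp only [altExp, weylDenom, map_smul, inner_smul_right] at h2
    rw [h2, prod_div_distrib, prod_const]
  simp only [h1]
  rw [show (2 : ℝ) ^ #Sp * piP Sp Y = ∏ α ∈ Sp, 2 * ⟪α, Y⟫ by
    rw [piP, prod_mul_distrib, prod_const]]
  refine tendsto_finsetProd _ fun α _ => ?_
  have h3 : HasDerivAt (fun t : ℝ => Real.exp (t * ⟪α, Y⟫) - Real.exp (-(t * ⟪α, Y⟫)))
      (2 * ⟪α, Y⟫) 0 := by
    have h4 : HasDerivAt (fun t : ℝ => t * ⟪α, Y⟫) ⟪α, Y⟫ 0 := hasDerivAt_mul_const _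
    refine (h4.exp.sub h4.neg.exp).congr_deriv ?_
    simp
    ring
  have h5 := h3.tendsto_slope_zero
  simpa [div_eq_inv_mul] using h5

theorem tendsto_altKernel_rho (h : IsPosRoots Sig Sp v) {Y : E d} (hY : Y ≠ 0)
    (hreg : piP Sp Y ≠ 0) :
    Filter.Tendsto (fun t : ℝ => (piP Sp (t • ∑ α ∈ Sp, α) * piP Sp Y)⁻¹ *
        altKernel Sig (t • ∑ α ∈ Sp, α, Y)) (nhdsWithin 0 {0}ᶜ)
      (nhds (2 ^ (2 * #Sp) * (∏ k ∈ range #Sp, ((d : ℝ) / 2 + (k : ℝ))) /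
          piP Sp (∑ α ∈ Sp, α) * ‖Y‖ ^ (-(d : ℝ) - 2 * (#Sp : ℝ)))) := by
  obtain ⟨hzero, hM⟩ := h.alternating_moments Y
  have hπ := h.piP_rho_pos.ne'
  have hY0 : 0 < ‖Y‖ := norm_pos_iff.2 hY
  have hr : Filter.Tendsto (fun t : ℝ => t ^ 2 * ‖∑ α ∈ Sp, α‖ ^ 2 + ‖Y‖ ^ 2)
      (nhdsWithin 0 {0}ᶜ) (nhds (‖Y‖ ^ 2)) := by
    have h1 : Continuous fun t : ℝ => t ^ 2 * ‖∑ α ∈ Sp, α‖ ^ 2 + ‖Y‖ ^ 2 := by fun_prop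
    have h2 := h1.tendsto 0
    simp only [ne_eq, OfNat.ofNat_ne_zero, not_false_eq_true, zero_pow, zero_mul, zero_add] at h2
    exact h2.mono_left nhdsWithin_le_nhds
  have hlim := (tendsto_sum_rpow_div_pow _ _ (#Sp) ((d : ℝ) / 2) _ hzero hM _ _
    (by positivity) hr).const_mul (piP Sp (∑ α ∈ Sp, α) * piP Sp Y)⁻¹
  have hval : (piP Sp (∑ α ∈ Sp, α) * piP Sp Y)⁻¹ * ((‖Y‖ ^ 2) ^ (-((d : ℝ) / 2)) *
      ((∏ j ∈ range #Sp, ((d : ℝ) / 2 + j)) / (#Sp).factorial *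
        ((#Sp).factorial * (2 ^ #Sp * piP Sp Y)) * (2 / ‖Y‖ ^ 2) ^ #Sp)) =
      2 ^ (2 * #Sp) * (∏ k ∈ range #Sp, ((d : ℝ) / 2 + (k : ℝ))) /
          piP Sp (∑ α ∈ Sp, α) * ‖Y‖ ^ (-(d : ℝ) - 2 * (#Sp : ℝ)) := by
    have h1 : (‖Y‖ ^ 2) ^ (-((d : ℝ) / 2)) = ‖Y‖ ^ (-(d : ℝ)) := by
      rw [← Real.rpow_natCast, ← Real.rpow_mul hY0.le]
      congr 1
      push_cast
      ring
    have h2 : ‖Y‖ ^ (-(d : ℝ) - 2 * (#Sp : ℝ)) = ‖Y‖ ^ (-(d : ℝ)) / (‖Y‖ ^ 2) ^ #Sp := by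
      rw [Real.rpow_sub hY0, ← pow_mul, ← Real.rpow_natCast]
      push_cast
      rfl
    have h3 : ((#Sp).factorial : ℝ) ≠ 0 := Nat.cast_ne_zero.2 (Nat.factorial_ne_zero _)
    rw [h1, h2, div_pow, pow_mul', sq]
    field_simp
  rw [hval] at hlim
  refine hlim.congr fun t => ?_
  have hnorm : ∀ w : ↥(weylGroup Sig), ‖t • ∑ α ∈ Sp, α - w.1 Y‖ ^ (-(d : ℝ)) =
      (t ^ 2 * ‖∑ α ∈ Sp, α‖ ^ 2 + ‖Y‖ ^ 2 - 2 * t * ⟪∑ α ∈ Sp, α, w.1 Y⟫) ^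
        (-((d : ℝ) / 2)) := fun w => by
    have h1 : t ^ 2 * ‖∑ α ∈ Sp, α‖ ^ 2 + ‖Y‖ ^ 2 - 2 * t * ⟪∑ α ∈ Sp, α, w.1 Y⟫ =
        ‖t • ∑ α ∈ Sp, α - w.1 Y‖ ^ 2 := by
      rw [norm_sub_sq_real, norm_smul, inner_smul_left, w.1.norm_map, mul_pow, Real.norm_eq_abs,
        sq_abs]
      simp only [conj_trivial]
      ring
    rw [h1, ← Real.rpow_natCast, ← Real.rpow_mul (norm_nonneg _)]
    congr 1
    push_cast
    ring
  simp only [altKernel, hnorm, piP_smul]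
  rw [mul_inv, mul_inv, mul_inv]
  ring

end IsPosRoots

/-- For a crystallographic root system, there is a unique continuous function
`T` on `D` with `T(X,Y) = (π(X)π(Y))⁻¹ ∑_{w ∈ W} det(w) |X - wY|^{-d}` whenever
`π(X)π(Y) ≠ 0`; and `T(0,Y) = 2^{2γ} (d/2)_γ / π(ρ) · |Y|^{-d-2γ}` for every `Y ≠ 0`. -/
theorem stmt_4 (d : ℕ) (hd : 1 ≤ d) (Sig Sp : Finset (E d))
    (hroot : IsRootSystem Sig) (hpos : IsPositiveSystem Sig Sp)
    (hcrys : ∀ α ∈ Sig, ∀ β ∈ Sig, ∃ z : ℤ, 2 * ⟪α, β⟫ / ⟪β, β⟫ = (z : ℝ))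
    [Fintype ↥(weylGroup Sig)] :
    ∃ T : E d × E d → ℝ,
      ContinuousOn T (Dset Sig) ∧
      (∀ X Y : E d, (X, Y) ∈ Dset Sig → piP Sp X * piP Sp Y ≠ 0 →
        T (X, Y) = (piP Sp X * piP Sp Y)⁻¹ *
          ∑ w : ↥(weylGroup Sig), dsign w.1 * ‖X - w.1 Y‖ ^ (-(d : ℝ))) ∧
      (∀ T' : E d × E d → ℝ,
        ContinuousOn T' (Dset Sig) →
        (∀ X Y : E d, (X, Y) ∈ Dset Sig → piP Sp X * piP Sp Y ≠ 0 →
          T' (X, Y) = (piP Sp X * piP Sp Y)⁻¹ *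
            ∑ w : ↥(weylGroup Sig), dsign w.1 * ‖X - w.1 Y‖ ^ (-(d : ℝ))) →
        ∀ p ∈ Dset Sig, T' p = T p) ∧
      (∀ Y : E d, Y ≠ 0 →
        T (0, Y) = 2 ^ (2 * Sp.card) *
          (∏ k ∈ Finset.range Sp.card, ((d : ℝ) / 2 + (k : ℝ))) /
          piP Sp (∑ α ∈ Sp, α) * ‖Y‖ ^ (-(d : ℝ) - 2 * (Sp.card : ℝ))) := by
  obtain ⟨v, hv, hmem⟩ := hpos
  have h : IsPosRoots Sig Sp v := ⟨hroot, hcrys, hv, hmem⟩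
  let A : Set (E d × E d) := {p | piP Sp p.1 * piP Sp p.2 ≠ 0}
  let f : E d × E d → ℝ := fun p => (piP Sp p.1 * piP Sp p.2)⁻¹ * altKernel Sig p
  have hopen : IsOpen (Dset Sig) := isOpen_Dset
  have hA : Dense A := h.dense_regular
  have hlim : ∀ p ∈ Dset Sig, ∃ y, Filter.Tendsto f (nhdsWithin p A) (nhds y) := by
    intro p hp
    obtain ⟨G, hG, hfac⟩ := h.exists_altKernel_eq_mul hp
    refine ⟨G p, (hG.continuousAt.tendsto.mono_left nhdsWithin_le_nhds).congr' ?_⟩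
    filter_upwards [nhdsWithin_le_nhds hfac, self_mem_nhdsWithin] with q hq hqA
    change G q = (piP Sp q.1 * piP Sp q.2)⁻¹ * altKernel Sig q
    rw [hq, inv_mul_cancel_left₀ hqA]
  have hcont : ContinuousOn (extendFrom A f) (Dset Sig) :=
    continuousOn_extendFrom (fun p _ => hA p) hlim
  have hformula : ∀ p ∈ Dset Sig, p ∈ A → extendFrom A f p = f p := by
    intro p hp hpA
    refine extendFrom_eq (hA p) (ContinuousAt.tendsto ?_ |>.mono_left nhdsWithin_le_nhds)
    refine ContinuousAt.mul (ContinuousAt.inv₀ ?_ hpA) (contDiffAt_altKernel hp).continuousAt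
    exact (((continuous_piP Sp).comp continuous_fst).mul
      ((continuous_piP Sp).comp continuous_snd)).continuousAt
  refine ⟨extendFrom A f, hcont, fun X Y hD hne => hformula (X, Y) hD hne, ?_, ?_⟩
  · intro T' hT' hform p hp
    have : Filter.NeBot (nhdsWithin p A) := mem_closure_iff_nhdsWithin_neBot.1 (hA p)
    have hDp : Dset Sig ∈ nhds p := hopen.mem_nhds hp
    refine tendsto_nhds_unique_of_eventuallyEq
      ((hT'.continuousAt hDp).tendsto.mono_left (nhdsWithin_le_nhds (s := A)))
      ((hcont.continuousAt hDp).tendsto.mono_left nhdsWithin_le_nhds) ?_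
    filter_upwards [nhdsWithin_le_nhds hDp, self_mem_nhdsWithin] with q hqD hqA
    rw [hformula q hqD hqA]
    exact hform q.1 q.2 hqD hqA
  · have hcontAt : ∀ Y : E d, Y ≠ 0 → ContinuousAt (extendFrom A f) (0, Y) := fun Y hY =>
      hcont.continuousAt (hopen.mem_nhds (zero_prod_mem_Dset hY))
    have hreg : ∀ Y : E d, Y ≠ 0 → piP Sp Y ≠ 0 → extendFrom A f (0, Y) =
        2 ^ (2 * Sp.card) * (∏ k ∈ Finset.range Sp.card, ((d : ℝ) / 2 + (k : ℝ))) /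
          piP Sp (∑ α ∈ Sp, α) * ‖Y‖ ^ (-(d : ℝ) - 2 * (Sp.card : ℝ)) := by
      intro Y hY hπ
      have hpath : Filter.Tendsto (fun t : ℝ => (t • ∑ α ∈ Sp, α, Y)) (nhdsWithin 0 {0}ᶜ)
          (nhds ((0 : E d), Y)) := by
        have h1 : Continuous fun t : ℝ => (t • ∑ α ∈ Sp, α, Y) := by fun_prop
        have h2 := h1.tendsto 0
        rw [zero_smul] at h2
        exact h2.mono_left nhdsWithin_le_nhds
      refine tendsto_nhds_unique_of_eventuallyEq ((hcontAt Y hY).tendsto.comp hpath)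
        (h.tendsto_altKernel_rho hY hπ) ?_
      filter_upwards [hpath (hopen.mem_nhds (zero_prod_mem_Dset hY)),
        self_mem_nhdsWithin] with t htD ht
      refine hformula _ htD (mul_ne_zero ?_ hπ)
      rw [piP_smul]
      exact mul_ne_zero (pow_ne_zero _ ht) h.piP_rho_pos.ne'
    intro Y hY
    have : Filter.NeBot (nhdsWithin Y {Z : E d | piP Sp Z ≠ 0}) :=
      mem_closure_iff_nhdsWithin_neBot.1 (h.dense_piP_ne_zero Y)
    have hleft : ContinuousAt (fun Z : E d => extendFrom A f (0, Z)) Y :=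
      (hcontAt Y hY).comp (f := fun Z : E d => ((0 : E d), Z)) (by fun_prop)
    have hright : ContinuousAt (fun Z : E d =>
        2 ^ (2 * Sp.card) * (∏ k ∈ Finset.range Sp.card, ((d : ℝ) / 2 + (k : ℝ))) /
          piP Sp (∑ α ∈ Sp, α) * ‖Z‖ ^ (-(d : ℝ) - 2 * (Sp.card : ℝ))) Y :=
      continuousAt_const.mul (continuous_norm.continuousAt.rpow_const
        (Or.inl (norm_ne_zero_iff.2 hY)))
    refine tendsto_nhds_unique_of_eventuallyEq
      (hleft.tendsto.mono_left (nhdsWithin_le_nhds (s := {Z : E d | piP Sp Z ≠ 0})))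
      (hright.tendsto.mono_left nhdsWithin_le_nhds) ?_
    filter_upwards [nhdsWithin_le_nhds (isOpen_ne.mem_nhds hY), self_mem_nhdsWithin] with Z hZ hZr
    exact hreg Z hZ hZr
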